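/- (Estimate (omegarhok-5.1), single-interval exponential growth in the proof of Theorem B(a)) Let u be a weak stationary solution density and let U be an anti-Lyapunov function in 𝒰 with respect to ℒ with anti-Lyapunov constant γ > 0, essential lower bound ρ_m and essential upper bound ρ_M. Let H be an upper sandwich function for U with H(t) > 0 for all t ∈ [ρ_m, ρ_M), and assume condition (R): for Lebesgue-a.e. ρ ∈ [ρ_m, ρ_M), ∇U(x) ≠ 0 for every x ∈ U^{-1}(ρ). Set Ω*_{ρ_m} = {x ∈ 𝒰 : U(x) ≤ ρ_m}. If ρ_m < η̃ ≤ η < ρ_M and every ρ ∈ (η̃, η) satisfies ∇U(x) ≠ 0 for all x ∈ U^{-1}(ρ), then μ(Ω_η \ Ω*_{ρ_m}) ≥ μ(Ω_{η̃} \ Ω*_{ρ_m}) · exp(γ ∫_{η̃}^{η} dt / H(t)). -/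

import Mathlib

open MeasureTheory

noncomputable section

/-- Euclidean space ℝⁿ. -/
abbrev Eucl (n : ℕ) : Type := EuclideanSpace ℝ (Fin n)

/-- First-order partial derivative `∂ᵢ f`. -/
def pd {n : ℕ} (f : Eucl n → ℝ) (i : Fin n) (x : Eucl n) : ℝ :=
  fderiv ℝ f x (EuclideanSpace.single i 1)

/-- Second-order partial derivative `∂²ᵢⱼ f`. -/
def pd2 {n : ℕ} (f : Eucl n → ℝ) (i j : Fin n) (x : Eucl n) : ℝ :=
  fderiv ℝ (fun y => fderiv ℝ f y (EuclideanSpace.single j 1)) x (EuclideanSpace.single i 1)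

/-- The adjoint Fokker–Planck operator `ℒf = aⁱʲ ∂²ᵢⱼ f + Vⁱ ∂ᵢ f`. -/
def Lop {n : ℕ} (a : Eucl n → Matrix (Fin n) (Fin n) ℝ)
    (V : Eucl n → Fin n → ℝ) (f : Eucl n → ℝ) (x : Eucl n) : ℝ :=
  (∑ i, ∑ j, a x i j * pd2 f i j x) + ∑ i, V x i * pd f i x

/-- The quadratic form `⟨a(x) ∇f(x), ∇f(x)⟩ = ∑ᵢⱼ aⁱʲ ∂ᵢf ∂ⱼf`. -/
def aQuad {n : ℕ} (a : Eucl n → Matrix (Fin n) (Fin n) ℝ)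
    (f : Eucl n → ℝ) (x : Eucl n) : ℝ :=
  ∑ i, ∑ j, a x i j * pd f i x * pd f j x

open scoped Convolution in
theorem pd_convolution {n : ℕ} {φ g : Eucl n → ℝ} (hφ : LocallyIntegrable φ)
    (hg : ContDiff ℝ 1 g) (hc : HasCompactSupport g) (i : Fin n) :
    pd (φ ⋆[ContinuousLinearMap.lsmul ℝ ℝ, volume] g) i =
      φ ⋆[ContinuousLinearMap.lsmul ℝ ℝ, volume] pd g i := by
  funext x
  have h := hc.hasFDerivAt_convolution_right (ContinuousLinearMap.lsmul ℝ ℝ) hφ hg x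
  have hex : ConvolutionExistsAt φ (fderiv ℝ g) x
      ((ContinuousLinearMap.lsmul ℝ ℝ).precompR (Eucl n)) volume :=
    (hc.fderiv ℝ).convolutionExists_right _ hφ (hg.continuous_fderiv one_ne_zero) x
  rw [pd, h.fderiv, convolution, ContinuousLinearMap.integral_apply hex]
  rfl

theorem contDiff_pd {n : ℕ} {f : Eucl n → ℝ} {k : ℕ∞} (hf : ContDiff ℝ (k + 1) f) (i : Fin n) :
    ContDiff ℝ k (pd f i) :=
  (hf.fderiv_right le_rfl).clm_apply contDiff_const

theorem hasCompactSupport_pd {n : ℕ} {f : Eucl n → ℝ} (hf : HasCompactSupport f) (i : Fin n) :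
    HasCompactSupport (pd f i) :=
  hf.fderiv_apply ℝ _

theorem Lop_congr {n : ℕ} (a : Eucl n → Matrix (Fin n) (Fin n) ℝ) (V : Eucl n → Fin n → ℝ)
    {f g : Eucl n → ℝ} {x : Eucl n} (h : f =ᶠ[nhds x] g) : Lop a V f x = Lop a V g x := by
  have h1 : ∀ i, pd f i x = pd g i x := fun i => by rw [pd, pd, h.fderiv_eq]
  have h2 : ∀ i j, pd2 f i j x = pd2 g i j x := fun i j => by
    have : (fun y => fderiv ℝ f y (EuclideanSpace.single j 1)) =ᶠ[nhds x]
        fun y => fderiv ℝ g y (EuclideanSpace.single j 1) := by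
      filter_upwards [h.fderiv (𝕜 := ℝ)] with y hy
      rw [hy]
    rw [pd2, pd2, this.fderiv_eq]
  simp only [Lop, h1, h2]

theorem Lop_eq_zero_of_notMem_tsupport {n : ℕ} (a : Eucl n → Matrix (Fin n) (Fin n) ℝ)
    (V : Eucl n → Fin n → ℝ) {f : Eucl n → ℝ} {x : Eucl n} (hx : x ∉ tsupport f) :
    Lop a V f x = 0 := by
  rw [Lop_congr a V (notMem_tsupport_iff_eventuallyEq.1 hx)]
  have h1 : ∀ i, pd (0 : Eucl n → ℝ) i = 0 := fun i => by funext y; simp [pd]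
  have h2 : ∀ i j, pd2 (0 : Eucl n → ℝ) i j x = 0 := fun i j => by
    change pd (pd 0 j) i x = 0
    simp [h1]
  simp [Lop, h1, h2]

theorem continuousOn_pd {n : ℕ} {𝒰 : Set (Eucl n)} (h𝒰 : IsOpen 𝒰) {f : Eucl n → ℝ}
    (hf : ContDiffOn ℝ 1 f 𝒰) (i : Fin n) : ContinuousOn (pd f i) 𝒰 :=
  (hf.continuousOn_fderiv_of_isOpen h𝒰 le_rfl).clm_apply continuousOn_const

theorem contDiffOn_pd {n : ℕ} {𝒰 : Set (Eucl n)} (h𝒰 : IsOpen 𝒰) {f : Eucl n → ℝ}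
    (hf : ContDiffOn ℝ 2 f 𝒰) (i : Fin n) : ContDiffOn ℝ 1 (pd f i) 𝒰 :=
  (hf.fderiv_of_isOpen h𝒰 (by norm_num)).clm_apply contDiffOn_const

theorem continuousOn_Lop {n : ℕ} {𝒰 : Set (Eucl n)} (h𝒰 : IsOpen 𝒰)
    {a : Eucl n → Matrix (Fin n) (Fin n) ℝ} (ha : ∀ i j, ContinuousOn (fun x => a x i j) 𝒰)
    {V : Eucl n → Fin n → ℝ} (hV : ContinuousOn V 𝒰) {f : Eucl n → ℝ}
    (hf : ContDiffOn ℝ 2 f 𝒰) : ContinuousOn (Lop a V f) 𝒰 := by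
  have h1 := fun i => continuousOn_pd h𝒰 (hf.of_le one_le_two) i
  have h2 : ∀ i j, ContinuousOn (pd2 f i j) 𝒰 := fun i j =>
    continuousOn_pd h𝒰 (contDiffOn_pd h𝒰 hf j) i
  have h3 := continuousOn_pi.1 hV
  exact (continuousOn_finsetSum _ fun i _ => continuousOn_finsetSum _ fun j _ =>
    (ha i j).mul (h2 i j)).add (continuousOn_finsetSum _ fun i _ => (h3 i).mul (h1 i))

theorem continuousOn_aQuad {n : ℕ} {𝒰 : Set (Eucl n)} (h𝒰 : IsOpen 𝒰)
    {a : Eucl n → Matrix (Fin n) (Fin n) ℝ} (ha : ∀ i j, ContinuousOn (fun x => a x i j) 𝒰)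
    {f : Eucl n → ℝ} (hf : ContDiffOn ℝ 1 f 𝒰) : ContinuousOn (aQuad a f) 𝒰 := by
  have h1 := fun i => continuousOn_pd h𝒰 hf i
  exact continuousOn_finsetSum _ fun i _ => continuousOn_finsetSum _ fun j _ =>
    ((ha i j).mul (h1 i)).mul (h1 j)

/-- A function continuous on an open set and vanishing off a compact subset is a bounded
multiplier of integrable functions. -/
theorem integrableOn_mul_of_eq_zero_off_isCompact {n : ℕ} {𝒰 K : Set (Eucl n)}
    (h𝒰 : IsOpen 𝒰) (hK : IsCompact K) (hK𝒰 : K ⊆ 𝒰) {u h : Eucl n → ℝ}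
    (hu : IntegrableOn u 𝒰) (hh : ContinuousOn h 𝒰) (h0 : ∀ x ∈ 𝒰, x ∉ K → h x = 0) :
    IntegrableOn (fun x => h x * u x) 𝒰 := by
  obtain ⟨C, hC⟩ := hK.exists_bound_of_continuousOn (hh.mono hK𝒰)
  refine Integrable.bdd_mul (c := max C 0) hu (hh.aestronglyMeasurable h𝒰.measurableSet) ?_
  filter_upwards [ae_restrict_mem h𝒰.measurableSet] with x hx
  by_cases hxK : x ∈ K
  · exact (hC x hxK).trans (le_max_left _ _)
  · simp [h0 x hx hxK]

theorem abs_Lop_sub_le {n : ℕ} (a : Eucl n → Matrix (Fin n) (Fin n) ℝ) (V : Eucl n → Fin n → ℝ)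
    {f g : Eucl n → ℝ} {x : Eucl n} {ε : ℝ} (h1 : ∀ i, |pd f i x - pd g i x| ≤ ε)
    (h2 : ∀ i j, |pd2 f i j x - pd2 g i j x| ≤ ε) :
    |Lop a V f x - Lop a V g x| ≤ ((∑ i, ∑ j, |a x i j|) + ∑ i, |V x i|) * ε := by
  have : Lop a V f x - Lop a V g x =
      (∑ i, ∑ j, a x i j * (pd2 f i j x - pd2 g i j x)) + ∑ i, V x i * (pd f i x - pd g i x) := by
    simp only [Lop, mul_sub, Finset.sum_sub_distrib]
    ring
  rw [this, add_mul, Finset.sum_mul, Finset.sum_mul]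
  refine (abs_add_le _ _).trans (add_le_add ?_ ?_)
  · refine (Finset.abs_sum_le_sum_abs _ _).trans (Finset.sum_le_sum fun i _ => ?_)
    rw [Finset.sum_mul]
    refine (Finset.abs_sum_le_sum_abs _ _).trans (Finset.sum_le_sum fun j _ => ?_)
    rw [abs_mul]
    exact mul_le_mul_of_nonneg_left (h2 i j) (abs_nonneg _)
  · refine (Finset.abs_sum_le_sum_abs _ _).trans (Finset.sum_le_sum fun i _ => ?_)
    rw [abs_mul]
    exact mul_le_mul_of_nonneg_left (h1 i) (abs_nonneg _)

open scoped Convolution in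
/-- A compactly supported `C²` function is approximated, together with its partial derivatives
up to order two, by smooth functions supported near its support. -/
theorem exists_contDiff_approx {n : ℕ} {f : Eucl n → ℝ} (hf : ContDiff ℝ 2 f)
    (hc : HasCompactSupport f) {δ ε : ℝ} (hδ : 0 < δ) (hε : 0 < ε) :
    ∃ g : Eucl n → ℝ, ContDiff ℝ (⊤ : ℕ∞) g ∧ HasCompactSupport g ∧
      tsupport g ⊆ Metric.cthickening δ (tsupport f) ∧
      (∀ i x, |pd g i x - pd f i x| ≤ ε) ∧ ∀ i j x, |pd2 g i j x - pd2 f i j x| ≤ ε := by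
  have hp1 : ∀ i, ContDiff ℝ 1 (pd f i) := fun i => contDiff_pd (k := 1) (by simpa [one_add_one_eq_two] using hf) i
  have hc1 : ∀ i, HasCompactSupport (pd f i) := fun i => hasCompactSupport_pd hc i
  have hp2 : ∀ i j, ContDiff ℝ 0 (pd (pd f j) i) := fun i j =>
    contDiff_pd (k := 0) (by simpa using hp1 j) i
  have hc2 : ∀ i j, HasCompactSupport (pd (pd f j) i) := fun i j => hasCompactSupport_pd (hc1 j) i
  have key : ∀ g : Eucl n → ℝ, Continuous g → HasCompactSupport g →
      ∀ᶠ r in nhdsWithin (0 : ℝ) (Set.Ioi 0), ∀ x y, dist x y < r → dist (g x) (g y) ≤ ε := by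
    intro g hg hgc
    obtain ⟨r, hr, h⟩ := Metric.uniformContinuous_iff.1
      (hgc.uniformContinuous_of_continuous hg) ε hε
    filter_upwards [Ioo_mem_nhdsGT hr] with s hs x y hxy
    exact (h (hxy.trans hs.2)).le
  have e1 := Filter.eventually_all.2 fun i => key _ (hp1 i).continuous (hc1 i)
  have e2 := Filter.eventually_all.2 fun i => Filter.eventually_all.2 fun j =>
    key _ (hp2 i j).continuous (hc2 i j)
  obtain ⟨r, ⟨h1, h2⟩, hr0, hrδ⟩ := ((e1.and e2).and (Ioo_mem_nhdsGT hδ)).exists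
  let φ : ContDiffBump (0 : Eucl n) := ⟨r / 2, r, half_pos hr0, half_lt_self hr0⟩
  have hφ : LocallyIntegrable (φ.normed volume) :=
    (φ.continuous_normed (μ := volume)).locallyIntegrable
  have hφc : HasCompactSupport (φ.normed volume) := φ.hasCompactSupport_normed
  have q1 : ∀ i, pd (φ.normed volume ⋆[ContinuousLinearMap.lsmul ℝ ℝ, volume] f) i =
      φ.normed volume ⋆[ContinuousLinearMap.lsmul ℝ ℝ, volume] pd f i := fun i =>
    pd_convolution hφ (hf.of_le one_le_two) hc i
  refine ⟨φ.normed volume ⋆[ContinuousLinearMap.lsmul ℝ ℝ, volume] f,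
    hφc.contDiff_convolution_left _ φ.contDiff_normed hf.continuous.locallyIntegrable,
    hφc.convolution _ hc, ?_, ?_, ?_⟩
  · refine closure_minimal ?_ Metric.isClosed_cthickening
    refine (support_convolution_subset _).trans ?_
    rintro _ ⟨y, hy, z, hz, rfl⟩
    rw [φ.support_normed_eq, mem_ball_zero_iff] at hy
    refine Metric.mem_cthickening_of_dist_le _ z _ _ (subset_tsupport _ hz) ?_
    have : dist (y + z) z = ‖y‖ := by simp [dist_eq_norm]
    exact this.le.trans (hy.le.trans hrδ.le)
  · intro i x
    rw [q1]
    exact ContDiffBump.dist_normed_convolution_le (hp1 i).continuous.aestronglyMeasurable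
      fun y hy => h1 i y x hy
  · intro i j x
    change |pd (pd _ j) i x - pd (pd f j) i x| ≤ ε
    rw [q1, pd_convolution hφ (hp1 j) (hc1 j)]
    exact ContDiffBump.dist_normed_convolution_le (hp2 i j).continuous.aestronglyMeasurable
      fun y hy => h2 i j y x hy

/-- Weak stationarity extends from smooth to `C²` test functions. -/
theorem integral_Lop_mul_eq_zero_of_contDiff_two {n : ℕ} {𝒰 : Set (Eucl n)} (h𝒰 : IsOpen 𝒰)
    {a : Eucl n → Matrix (Fin n) (Fin n) ℝ} (ha : ∀ i j, ContinuousOn (fun x => a x i j) 𝒰)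
    {V : Eucl n → Fin n → ℝ} (hV : ContinuousOn V 𝒰) {u : Eucl n → ℝ} (hu : IntegrableOn u 𝒰)
    (hstat : ∀ f : Eucl n → ℝ, ContDiff ℝ (⊤ : ℕ∞) f → HasCompactSupport f →
      tsupport f ⊆ 𝒰 → (∫ x in 𝒰, Lop a V f x * u x) = 0)
    {f : Eucl n → ℝ} (hf : ContDiff ℝ 2 f) (hc : HasCompactSupport f) (hs : tsupport f ⊆ 𝒰) :
    (∫ x in 𝒰, Lop a V f x * u x) = 0 := by
  obtain ⟨δ, hδ, hδ𝒰⟩ := hc.isCompact.exists_cthickening_subset_open h𝒰 hs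
  set K := Metric.cthickening δ (tsupport f)
  have hK : IsCompact K := hc.isCompact.cthickening
  have hA : ContinuousOn (fun x => (∑ i, ∑ j, |a x i j|) + ∑ i, |V x i|) 𝒰 :=
    (continuousOn_finsetSum _ fun i _ => continuousOn_finsetSum _ fun j _ => (ha i j).abs).add
      (continuousOn_finsetSum _ fun i _ => (continuousOn_pi.1 hV i).abs)
  obtain ⟨C, hC⟩ := hK.exists_bound_of_continuousOn (hA.mono hδ𝒰)
  have hint : ∀ g : Eucl n → ℝ, ContDiff ℝ 2 g → HasCompactSupport g → tsupport g ⊆ 𝒰 →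
      IntegrableOn (fun x => Lop a V g x * u x) 𝒰 := fun g hg hgc hgs =>
    integrableOn_mul_of_eq_zero_off_isCompact h𝒰 hgc.isCompact hgs hu
      (continuousOn_Lop h𝒰 ha hV hg.contDiffOn)
      fun x _ hx => Lop_eq_zero_of_notMem_tsupport a V hx
  set B := ∫ x in 𝒰, |u x|
  have hB : 0 ≤ B := integral_nonneg fun x => abs_nonneg _
  have hmain : ∀ ε : ℝ, 0 < ε → |∫ x in 𝒰, Lop a V f x * u x| ≤ max C 0 * B * ε := by
    intro ε hε
    obtain ⟨g, hg, hgc, hgs, h1, h2⟩ := exists_contDiff_approx hf hc hδ hε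
    have hg2 : ContDiff ℝ 2 g := contDiff_infty.1 hg 2
    have hsub : (∫ x in 𝒰, Lop a V f x * u x) =
        -∫ x in 𝒰, (Lop a V g x * u x - Lop a V f x * u x) := by
      rw [integral_sub (hint g hg2 hgc (hgs.trans hδ𝒰)) (hint f hf hc hs),
        hstat g hg hgc (hgs.trans hδ𝒰)]
      ring
    rw [hsub, abs_neg]
    have hbd : max C 0 * B * ε = ∫ x in 𝒰, max C 0 * ε * |u x| := by
      rw [integral_const_mul]; ring
    rw [hbd, ← Real.norm_eq_abs]
    refine norm_integral_le_of_norm_le (hu.abs.const_mul _) (Filter.Eventually.of_forall fun x => ?_)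
    rw [← sub_mul, norm_mul, Real.norm_eq_abs, Real.norm_eq_abs]
    refine mul_le_mul_of_nonneg_right ?_ (abs_nonneg _)
    by_cases hx : x ∈ K
    · refine (abs_Lop_sub_le a V (fun i => h1 i x) fun i j => h2 i j x).trans ?_
      exact mul_le_mul_of_nonneg_right
        ((le_abs_self _).trans ((hC x hx).trans (le_max_left _ _))) hε.le
    · rw [Lop_eq_zero_of_notMem_tsupport a V fun h => hx (hgs h),
        Lop_eq_zero_of_notMem_tsupport a V fun h => hx (Metric.self_subset_cthickening _ h)]
      simp only [sub_zero, abs_zero]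
      positivity
  by_contra hne
  have hpos := abs_pos.2 hne
  have hD : 0 ≤ max C 0 * B := by positivity
  have := hmain (|∫ x in 𝒰, Lop a V f x * u x| / (2 * (max C 0 * B + 1))) (by positivity)
  rw [mul_div_assoc', le_div_iff₀ (by positivity)] at this
  nlinarith

theorem pd_comp {n : ℕ} {φ : ℝ → ℝ} {U : Eucl n → ℝ} {x : Eucl n}
    (hφ : DifferentiableAt ℝ φ (U x)) (hU : DifferentiableAt ℝ U x) (i : Fin n) :
    pd (fun y => φ (U y)) i x = deriv φ (U x) * pd U i x := by
  have h := (hφ.hasDerivAt.comp_hasFDerivAt x hU.hasFDerivAt).fderiv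
  change fderiv ℝ (φ ∘ U) x _ = _
  rw [h]
  rfl

theorem Lop_comp {n : ℕ} {𝒰 : Set (Eucl n)} (h𝒰 : IsOpen 𝒰)
    (a : Eucl n → Matrix (Fin n) (Fin n) ℝ) (V : Eucl n → Fin n → ℝ) {φ : ℝ → ℝ}
    (hφ : ContDiff ℝ 2 φ) {U : Eucl n → ℝ} (hU : ContDiffOn ℝ 2 U 𝒰) {x : Eucl n} (hx : x ∈ 𝒰) :
    Lop a V (fun y => φ (U y)) x =
      deriv φ (U x) * Lop a V U x + deriv (deriv φ) (U x) * aQuad a U x := by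
  have hd : ∀ y ∈ 𝒰, DifferentiableAt ℝ U y := fun y hy =>
    (hU.differentiableOn two_ne_zero).differentiableAt (h𝒰.mem_nhds hy)
  have hφ1 : ContDiff ℝ 1 (deriv φ) := ((contDiff_succ_iff_deriv (n := 1)).1 hφ).2.2
  have h1 : ∀ i, ∀ y ∈ 𝒰, pd (fun y => φ (U y)) i y = deriv φ (U y) * pd U i y :=
    fun i y hy => pd_comp (hφ.differentiable two_ne_zero _) (hd y hy) i
  have h2 : ∀ i j, pd2 (fun y => φ (U y)) i j x =
      deriv φ (U x) * pd2 U i j x + deriv (deriv φ) (U x) * (pd U i x * pd U j x) := by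
    intro i j
    have e : (fun y => pd (fun y => φ (U y)) j y) =ᶠ[nhds x]
        fun y => deriv φ (U y) * pd U j y := by
      filter_upwards [h𝒰.mem_nhds hx] with y hy using h1 j y hy
    have hp : DifferentiableAt ℝ (pd U j) x :=
      ((contDiffOn_pd h𝒰 hU j).differentiableOn one_ne_zero).differentiableAt (h𝒰.mem_nhds hx)
    have hφd : DifferentiableAt ℝ (deriv φ) (U x) := hφ1.differentiable one_ne_zero _
    have hc : DifferentiableAt ℝ (fun y => deriv φ (U y)) x := hφd.comp x (hd x hx)
    change fderiv ℝ (fun y => pd (fun y => φ (U y)) j y) x (EuclideanSpace.single i 1) = _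
    rw [e.fderiv_eq, fderiv_fun_mul hc hp]
    change deriv φ (U x) * pd2 U i j x + pd U j x * pd (fun y => deriv φ (U y)) i x = _
    rw [pd_comp hφd (hd x hx)]
    ring
  simp only [Lop, aQuad, h2, h1 _ x hx, mul_add, Finset.sum_add_distrib, Finset.mul_sum]
  have e1 : ∀ i j, a x i j * (deriv φ (U x) * pd2 U i j x) =
    deriv φ (U x) * (a x i j * pd2 U i j x) := fun i j => by ring
  have e2 : ∀ i j, a x i j * (deriv (deriv φ) (U x) * (pd U i x * pd U j x)) =
    deriv (deriv φ) (U x) * (a x i j * pd U i x * pd U j x) := fun i j => by ring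
  have e3 : ∀ i, V x i * (deriv φ (U x) * pd U i x) =
    deriv φ (U x) * (V x i * pd U i x) := fun i => by ring
  simp only [e1, e2, e3]
  ring

/-- The stationarity identity tested against functions of a compact function `U`. -/
theorem integral_comp_compact_function_eq_zero {n : ℕ} {𝒰 : Set (Eucl n)} (h𝒰 : IsOpen 𝒰)
    {a : Eucl n → Matrix (Fin n) (Fin n) ℝ} (ha : ∀ i j, ContinuousOn (fun x => a x i j) 𝒰)
    {V : Eucl n → Fin n → ℝ} (hV : ContinuousOn V 𝒰) {u : Eucl n → ℝ} (hu : IntegrableOn u 𝒰)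
    (hstat : ∀ f : Eucl n → ℝ, ContDiff ℝ (⊤ : ℕ∞) f → HasCompactSupport f →
      tsupport f ⊆ 𝒰 → (∫ x in 𝒰, Lop a V f x * u x) = 0)
    {U : Eucl n → ℝ} (hU : ContDiffOn ℝ 2 U 𝒰) {r : ℝ} (hK : IsCompact {x ∈ 𝒰 | U x ≤ r})
    {ψ : ℝ → ℝ} (hψ : ContDiff ℝ 1 ψ) (hψ0 : ∀ t, r ≤ t → ψ t = 0) :
    IntegrableOn (fun x => (ψ (U x) * Lop a V U x + deriv ψ (U x) * aQuad a U x) * u x) 𝒰 ∧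
    (∫ x in 𝒰, (ψ (U x) * Lop a V U x + deriv ψ (U x) * aQuad a U x) * u x) = 0 := by
  classical
  set K := {x ∈ 𝒰 | U x ≤ r}
  let φ : ℝ → ℝ := fun t => ∫ s in r..t, ψ s
  have hφd : deriv φ = ψ := funext fun t => hψ.continuous.deriv_integral ψ r t
  have hφdiff : Differentiable ℝ φ := fun t =>
    (hψ.continuous.integral_hasStrictDerivAt r t).hasDerivAt.differentiableAt
  have hφ : ContDiff ℝ 2 φ :=
    (contDiff_succ_iff_deriv (n := 1)).2 ⟨hφdiff, by simp, by rwa [hφd]⟩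
  have hφ0 : ∀ t, r ≤ t → φ t = 0 := by
    intro t ht
    change ∫ s in r..t, ψ s = 0
    rw [intervalIntegral.integral_congr (g := fun _ => (0 : ℝ)), intervalIntegral.integral_zero]
    intro s hs
    rw [Set.uIcc_of_le ht] at hs
    exact hψ0 s hs.1
  let f : Eucl n → ℝ := fun x => if x ∈ 𝒰 then φ (U x) else 0
  have hf𝒰 : ∀ x ∈ 𝒰, f =ᶠ[nhds x] fun y => φ (U y) := fun x hx => by
    filter_upwards [h𝒰.mem_nhds hx] with y hy
    exact if_pos hy
  have hf0 : ∀ x, x ∉ K → f x = 0 := by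
    intro x hx
    by_cases h : x ∈ 𝒰
    · have : r ≤ U x := le_of_not_ge fun h' => hx ⟨h, h'⟩
      simp [f, hφ0 _ this]
    · exact if_neg h
  have hsupp : tsupport f ⊆ K :=
    closure_minimal (fun x hx => by_contra fun h => hx (hf0 x h)) hK.isClosed
  have hfc : HasCompactSupport f := hK.of_isClosed_subset (isClosed_tsupport f) hsupp
  have hK𝒰 : K ⊆ 𝒰 := fun x hx => hx.1
  have hf : ContDiff ℝ 2 f := by
    rw [contDiff_iff_contDiffAt]
    intro x
    by_cases hx : x ∈ 𝒰
    · exact (hφ.contDiffAt.comp x (hU.contDiffAt (h𝒰.mem_nhds hx))).congr_of_eventuallyEq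
        (hf𝒰 x hx)
    · exact contDiffAt_const.congr_of_eventuallyEq
        (notMem_tsupport_iff_eventuallyEq.1 fun h => hx (hK𝒰 (hsupp h)))
  have hL : ∀ x ∈ 𝒰, Lop a V f x =
      ψ (U x) * Lop a V U x + deriv ψ (U x) * aQuad a U x := by
    intro x hx
    rw [Lop_congr a V (hf𝒰 x hx), Lop_comp h𝒰 a V hφ hU hx, hφd]
  have hint : IntegrableOn (fun x => Lop a V f x * u x) 𝒰 :=
    integrableOn_mul_of_eq_zero_off_isCompact h𝒰 hK hK𝒰 hu
      (continuousOn_Lop h𝒰 ha hV hf.contDiffOn)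
      fun x _ hx => Lop_eq_zero_of_notMem_tsupport a V fun h => hx (hsupp h)
  refine ⟨hint.congr_fun (fun x hx => by simp only [hL x hx]) h𝒰.measurableSet, ?_⟩
  rw [← integral_Lop_mul_eq_zero_of_contDiff_two h𝒰 ha hV hu hstat hf hfc (hsupp.trans hK𝒰)]
  exact setIntegral_congr_fun h𝒰.measurableSet fun x hx => by simp only [hL x hx]

/-- Discrete-to-continuous Gronwall bound: additive increments at least `M s * (K t - K s)`
force exponential growth. -/
theorem mul_exp_le_of_increment_le {M K : ℝ → ℝ} {c d : ℝ} (hcd : c ≤ d)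
    (hK : ContinuousOn K (Set.Icc c d)) (hKcd : K c ≤ K d)
    (hM : ∀ s t, c ≤ s → s ≤ t → t ≤ d → M s * (1 + (K t - K s)) ≤ M t) :
    M c * Real.exp (K d - K c) ≤ M d := by
  have step : ∀ h : ℝ, 0 ≤ h → ∀ N : ℕ, ∀ t ∈ Set.Icc c d, K t - K c = N * h →
      M c * (1 + h) ^ N ≤ M t := by
    intro h hh N
    induction N with
    | zero =>
      intro t ht hKt
      have := hM c t le_rfl ht.1 ht.2
      rw [hKt] at this
      simpa using this
    | succ N ih =>
      intro t ht hKt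
      push_cast at hKt
      have hN : (0 : ℝ) ≤ N * h := by positivity
      obtain ⟨s, hs, hKs⟩ : K c + N * h ∈ K '' Set.Icc c t :=
        intermediate_value_Icc ht.1 (hK.mono (Set.Icc_subset_Icc_right ht.2))
          ⟨by linarith, by linarith⟩
      have h1 := ih s ⟨hs.1, hs.2.trans ht.2⟩ (by linarith)
      have h2 := hM s t hs.1 hs.2 ht.2
      have h3 : K t - K s = h := by linarith
      rw [h3] at h2
      rw [pow_succ, ← mul_assoc]
      exact (mul_le_mul_of_nonneg_right h1 (by linarith)).trans h2
  refine le_of_tendsto ((Real.tendsto_one_add_div_pow_exp (K d - K c)).const_mul (M c)) ?_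
  filter_upwards [Filter.eventually_gt_atTop 0] with N hN
  have hN' : (0 : ℝ) < N := by exact_mod_cast hN
  exact step _ (div_nonneg (by linarith) hN'.le) N d ⟨hcd, le_rfl⟩ (by field_simp)

/-- On an open set, finite measures are compared by nonnegative continuous compactly supported
test functions. -/
theorem measure_restrict_le_of_lintegral_le {μ ν : Measure ℝ} [IsFiniteMeasure μ]
    [IsFiniteMeasure ν] {O : Set ℝ} (hO : IsOpen O)
    (h : ∀ θ : ℝ → ℝ, Continuous θ → (∀ x, 0 ≤ θ x) → HasCompactSupport θ → tsupport θ ⊆ O →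
      ∫⁻ x, ENNReal.ofReal (θ x) ∂μ ≤ ∫⁻ x, ENNReal.ofReal (θ x) ∂ν) :
    μ.restrict O ≤ ν := by
  have hFW : ∀ F W : Set ℝ, IsCompact F → IsOpen W → F ⊆ W → W ⊆ O → μ F ≤ ν W := by
    intro F W hF hW hFW hWO
    obtain ⟨θ, h1, hc, hs, h01⟩ := exists_continuousMap_one_of_isCompact_subset_isOpen hF hW hFW
    calc μ F = ∫⁻ x, F.indicator 1 x ∂μ := (lintegral_indicator_one hF.measurableSet).symm
      _ ≤ ∫⁻ x, ENNReal.ofReal (θ x) ∂μ := lintegral_mono fun x => by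
          by_cases hx : x ∈ F
          · simp [hx, h1 hx]
          · simp [hx]
      _ ≤ ∫⁻ x, ENNReal.ofReal (θ x) ∂ν := h θ θ.continuous (fun x => (h01 x).1) hc (hs.trans hWO)
      _ ≤ ∫⁻ x, W.indicator 1 x ∂ν := lintegral_mono fun x => by
          by_cases hx : x ∈ W
          · simpa [hx] using (h01 x).2
          · simp [image_eq_zero_of_notMem_tsupport fun h => hx (hs h)]
      _ = ν W := lintegral_indicator_one hW.measurableSet
  refine Measure.le_iff.2 fun A hA => ?_
  rw [Measure.restrict_apply hA, (hA.inter hO.measurableSet).measure_eq_iSup_isCompact,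
    A.measure_eq_iInf_isOpen]
  refine iSup₂_le fun F hF => iSup_le fun hFc => le_iInf₂ fun W hW => le_iInf fun hWo => ?_
  exact (hFW F (W ∩ O) hFc (hWo.inter hO) (hF.trans (Set.inter_subset_inter_left _ hW))
    Set.inter_subset_right).trans (measure_mono Set.inter_subset_left)

theorem exists_contDiff_plateau {r r₀ s t : ℝ} (hr : r < r₀) (hrs : r₀ < s) {θ : ℝ → ℝ}
    (hθ : Continuous θ) (hθ0 : ∀ x, 0 ≤ θ x) (hθc : HasCompactSupport θ)
    (hθs : tsupport θ ⊆ Set.Ioo s t) :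
    ∃ ψ : ℝ → ℝ, ContDiff ℝ 1 ψ ∧ (∀ x, 0 ≤ ψ x) ∧ (∀ x, x ≤ r → ψ x = 0) ∧
      (∀ x, t ≤ x → ψ x = 0) ∧ (∀ x, r₀ ≤ x → x ≤ s → ψ x = ∫ y, θ y) ∧
      ∀ x, -θ x ≤ deriv ψ x := by
  set I := ∫ y, θ y
  have hI : 0 ≤ I := integral_nonneg hθ0
  have hθ_int : Integrable θ := hθ.integrable_of_hasCompactSupport hθc
  have hθz : ∀ x, x ∉ Set.Ioo s t → θ x = 0 := fun x hx =>
    image_eq_zero_of_notMem_tsupport fun h => hx (hθs h)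
  let β : ℝ → ℝ := fun x => Real.smoothTransition ((x - r) / (r₀ - r))
  have hβ : ContDiff ℝ 1 β :=
    (Real.smoothTransition.contDiff (n := 1)).comp ((contDiff_id.sub contDiff_const).div_const _)
  have hβm : Monotone β := fun x y hxy => Real.smoothTransition.monotone
    (div_le_div_of_nonneg_right (by linarith) (by linarith))
  have hβ0 : ∀ x, x ≤ r → β x = 0 := fun x hx =>
    Real.smoothTransition.zero_of_nonpos
      (div_nonpos_of_nonpos_of_nonneg (by linarith) (by linarith))
  have hβ1 : ∀ x, r₀ ≤ x → β x = 1 := fun x hx =>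
    Real.smoothTransition.one_of_one_le ((one_le_div (by linarith)).2 (by linarith))
  let Θ : ℝ → ℝ := fun x => ∫ y in r..x, θ y
  have hΘ' : ∀ x, HasDerivAt Θ (θ x) x := fun x =>
    (hθ.integral_hasStrictDerivAt r x).hasDerivAt
  have hΘ : ContDiff ℝ 1 Θ := contDiff_one_iff_deriv.2
    ⟨fun x => (hΘ' x).differentiableAt, by rwa [funext fun x => (hΘ' x).deriv]⟩
  have hΘ0 : ∀ x, x ≤ s → Θ x = 0 := by
    intro x hx
    change ∫ y in r..x, θ y = 0
    rw [intervalIntegral.integral_congr (g := fun _ => (0 : ℝ)), intervalIntegral.integral_zero]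
    intro y hy
    refine hθz y fun h => ?_
    have := hy.2.trans (max_le (hr.le.trans hrs.le) hx)
    linarith [h.1]
  have hΘ1 : ∀ x, t ≤ x → Θ x = I := by
    intro x hx
    refine intervalIntegral.integral_eq_integral_of_support_subset fun y hy => ?_
    have h : y ∈ Set.Ioo s t := by_contra fun h => hy (hθz y h)
    exact ⟨by linarith [h.1], by linarith [h.2]⟩
  have hΘI : ∀ x, s ≤ x → Θ x ≤ I := by
    intro x hx
    change ∫ y in r..x, θ y ≤ I
    rw [intervalIntegral.integral_of_le (by linarith)]
    exact setIntegral_le_integral hθ_int (Filter.Eventually.of_forall hθ0)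
  refine ⟨fun x => I * β x - Θ x, (contDiff_const.mul hβ).sub hΘ, ?_, ?_, ?_, ?_, ?_⟩
  · intro x
    rcases le_total x s with hx | hx
    · simp only [hΘ0 x hx, sub_zero]
      exact mul_nonneg hI (Real.smoothTransition.nonneg _)
    · simp only [hβ1 x (by linarith), mul_one, sub_nonneg]
      exact hΘI x hx
  · intro x hx
    simp [hβ0 x hx, hΘ0 x (by linarith)]
  · intro x hx
    rcases le_total x s with hxs | hxs
    · have h0 : I = 0 := by rw [← hΘ1 x hx, hΘ0 x hxs]
      simp [h0, hΘ0 x hxs]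
    · simp [hβ1 x (by linarith), hΘ1 x hx]
  · intro x h1 h2
    simp [hβ1 x h1, hΘ0 x h2]
  · intro x
    have hd := ((hβ.differentiable one_ne_zero x).hasDerivAt.const_mul I).sub (hΘ' x)
    change -θ x ≤ deriv ((fun y => I * β y) - Θ) x
    rw [hd.deriv]
    have := mul_nonneg hI (hβm.deriv_nonneg (x := x))
    linarith

section AntiLyapunov

variable {n : ℕ} {𝒰 : Set (Eucl n)} {U : Eucl n → ℝ}

theorem isOpen_sublevel_strip (h𝒰 : IsOpen 𝒰) (hU : ContinuousOn U 𝒰) (r s : ℝ) :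
    IsOpen {x ∈ 𝒰 | r < U x ∧ U x < s} :=
  hU.isOpen_inter_preimage h𝒰 isOpen_Ioo

variable {a : Eucl n → Matrix (Fin n) (Fin n) ℝ} {V : Eucl n → Fin n → ℝ} {u : Eucl n → ℝ}
  {ρm γ s t : ℝ}

theorem integrableOn_comp_mul_aQuad_mul (h𝒰 : IsOpen 𝒰)
    (ha : ∀ i j, ContinuousOn (fun x => a x i j) 𝒰) (hu : IntegrableOn u 𝒰)
    (hU : ContDiffOn ℝ 2 U 𝒰) (hK : IsCompact {x ∈ 𝒰 | U x ≤ t}) {θ : ℝ → ℝ}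
    (hθ : Continuous θ) (hθs : tsupport θ ⊆ Set.Ioo s t) :
    IntegrableOn (fun x => θ (U x) * aQuad a U x * u x) 𝒰 := by
  refine integrableOn_mul_of_eq_zero_off_isCompact h𝒰 hK (fun x hx => hx.1) hu
    ((hθ.comp_continuousOn hU.continuousOn).mul
      (continuousOn_aQuad h𝒰 ha (hU.of_le one_le_two))) ?_
  intro x hx hxK
  have : θ (U x) = 0 := image_eq_zero_of_notMem_tsupport fun h => hxK ⟨hx, (hθs h).2.le⟩
  simp [this]

/-- The mass of a strip below `s` controls the diffusion energy carried by levels above `s`. -/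
theorem strip_mass_mul_le_integral (h𝒰 : IsOpen 𝒰)
    (ha : ∀ i j, ContinuousOn (fun x => a x i j) 𝒰) (hQ : ∀ x ∈ 𝒰, 0 ≤ aQuad a U x)
    (hV : ContinuousOn V 𝒰) (hu : IntegrableOn u 𝒰) (hu0 : ∀ x ∈ 𝒰, 0 ≤ u x)
    (hstat : ∀ f : Eucl n → ℝ, ContDiff ℝ (⊤ : ℕ∞) f → HasCompactSupport f →
      tsupport f ⊆ 𝒰 → (∫ x in 𝒰, Lop a V f x * u x) = 0)
    (hU : ContDiffOn ℝ 2 U 𝒰) (hγ : 0 ≤ γ) (hL : ∀ x ∈ 𝒰, ρm < U x → γ ≤ Lop a V U x)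
    (hs : ρm < s) (hK : IsCompact {x ∈ 𝒰 | U x ≤ t}) {θ : ℝ → ℝ}
    (hθ : Continuous θ) (hθ0 : ∀ x, 0 ≤ θ x) (hθc : HasCompactSupport θ)
    (hθs : tsupport θ ⊆ Set.Ioo s t) :
    γ * (∫ x in {x ∈ 𝒰 | ρm < U x ∧ U x < s}, u x) * (∫ y, θ y) ≤
      ∫ x in 𝒰, θ (U x) * aQuad a U x * u x := by
  set I := ∫ y, θ y
  have hUc := hU.continuousOn
  have hsub : ∀ r, {x ∈ 𝒰 | r < U x ∧ U x < s} ⊆ 𝒰 := fun r x hx => hx.1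
  have hmeas : ∀ r, MeasurableSet {x ∈ 𝒰 | r < U x ∧ U x < s} := fun r =>
    (isOpen_sublevel_strip h𝒰 hUc r s).measurableSet
  have hθint := integrableOn_comp_mul_aQuad_mul h𝒰 ha hu hU hK hθ hθs
  have main : ∀ r ∈ Set.Ioo ρm s, γ * (∫ x in {x ∈ 𝒰 | r < U x ∧ U x < s}, u x) * I ≤
      ∫ x in 𝒰, θ (U x) * aQuad a U x * u x := by
    rintro r ⟨hr, hrs⟩
    obtain ⟨ψ, hψ, hψ0, hψr, hψt, hψI, hψ'⟩ := exists_contDiff_plateau hr hrs hθ hθ0 hθc hθs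
    obtain ⟨hint, hzero⟩ := integral_comp_compact_function_eq_zero h𝒰 ha hV hu hstat hU hK hψ hψt
    have hind : IntegrableOn
        (fun x => γ * I * ({x ∈ 𝒰 | r < U x ∧ U x < s}.indicator u x)) 𝒰 :=
      (Integrable.indicator hu (hmeas r)).const_mul (γ * I)
    have hle : (∫ x in 𝒰, (γ * I * ({x ∈ 𝒰 | r < U x ∧ U x < s}.indicator u x) -
        θ (U x) * aQuad a U x * u x)) ≤ 0 := by
      rw [← hzero]
      refine setIntegral_mono_on (hind.sub hθint) hint h𝒰.measurableSet fun x hx => ?_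
      have hux := hu0 x hx
      have hd : -(θ (U x) * aQuad a U x * u x) ≤ deriv ψ (U x) * aQuad a U x * u x := by
        rw [← neg_mul, ← neg_mul]
        exact mul_le_mul_of_nonneg_right
          (mul_le_mul_of_nonneg_right (hψ' _) (hQ x hx)) hux
      have hψL : γ * ψ (U x) ≤ ψ (U x) * Lop a V U x := by
        rcases le_or_gt (U x) ρm with h | h
        · simp [hψr _ h]
        · rw [mul_comm]
          exact mul_le_mul_of_nonneg_left (hL x hx h) (hψ0 _)
      have hi : γ * I * ({x ∈ 𝒰 | r < U x ∧ U x < s}.indicator u x) ≤ γ * ψ (U x) * u x := by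
        by_cases hxs : x ∈ {x ∈ 𝒰 | r < U x ∧ U x < s}
        · rw [Set.indicator_of_mem hxs, hψI _ hxs.2.1.le hxs.2.2.le]
        · rw [Set.indicator_of_notMem hxs, mul_zero]
          exact mul_nonneg (mul_nonneg hγ (hψ0 _)) hux
      nlinarith [mul_le_mul_of_nonneg_right hψL hux]
    rw [integral_sub hind hθint, integral_const_mul, setIntegral_indicator (hmeas r),
      Set.inter_eq_self_of_subset_right (hsub r)] at hle
    linarith
  obtain ⟨r, hranti, hr, hrlim⟩ := exists_seq_strictAnti_tendsto' hs
  have hUnion : (⋃ k, {x ∈ 𝒰 | r k < U x ∧ U x < s}) = {x ∈ 𝒰 | ρm < U x ∧ U x < s} := by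
    ext x
    simp only [Set.mem_iUnion, Set.mem_ofPred_eq]
    constructor
    · rintro ⟨k, hx, h1, h2⟩
      exact ⟨hx, (hr k).1.trans h1, h2⟩
    · rintro ⟨hx, h1, h2⟩
      obtain ⟨k, hk⟩ := (hrlim.eventually (gt_mem_nhds h1)).exists
      exact ⟨k, hx, hk, h2⟩
  have hlim := tendsto_setIntegral_of_monotone (μ := volume) (f := u) (fun k => hmeas (r k))
    (fun k l hkl x hx => ⟨hx.1, (hranti.antitone hkl).trans_lt hx.2.1, hx.2.2⟩)
    (by rw [hUnion]; exact hu.mono_set (hsub ρm))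
  rw [hUnion] at hlim
  exact le_of_tendsto ((hlim.const_mul γ).mul_const I)
    (Filter.Eventually.of_forall fun k => main (r k) (hr k))

/-- The mass gained between the levels `s` and `t` is bounded below by the mass under `s` times
the integral of `γ / H`. -/
theorem strip_mass_increment_le (h𝒰 : IsOpen 𝒰)
    (ha : ∀ i j, ContinuousOn (fun x => a x i j) 𝒰) (hQ : ∀ x ∈ 𝒰, 0 ≤ aQuad a U x)
    (hV : ContinuousOn V 𝒰) (hu : IntegrableOn u 𝒰) (hu0 : ∀ x ∈ 𝒰, 0 ≤ u x)
    (hstat : ∀ f : Eucl n → ℝ, ContDiff ℝ (⊤ : ℕ∞) f → HasCompactSupport f →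
      tsupport f ⊆ 𝒰 → (∫ x in 𝒰, Lop a V f x * u x) = 0)
    (hU : ContDiffOn ℝ 2 U 𝒰) (hγ : 0 ≤ γ) (hL : ∀ x ∈ 𝒰, ρm < U x → γ ≤ Lop a V U x)
    (hs : ρm < s) (hst : s ≤ t) (hK : IsCompact {x ∈ 𝒰 | U x ≤ t}) {H : ℝ → ℝ}
    (hHm : Measurable H) (hHpos : ∀ r ∈ Set.Ioo s t, 0 < H r)
    (hHup : ∀ x ∈ 𝒰, aQuad a U x ≤ H (U x))
    (hHint : IntervalIntegrable (fun r => 1 / H r) volume s t) :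
    γ * (∫ x in {x ∈ 𝒰 | ρm < U x ∧ U x < s}, u x) * (∫ r in s..t, 1 / H r) ≤
      ∫ x in {x ∈ 𝒰 | s < U x ∧ U x < t}, u x := by
  set W := {x ∈ 𝒰 | s < U x ∧ U x < t}
  set m := ∫ x in {x ∈ 𝒰 | ρm < U x ∧ U x < s}, u x
  have hUc := hU.continuousOn
  have hW : MeasurableSet W := (isOpen_sublevel_strip h𝒰 hUc s t).measurableSet
  have hW𝒰 : W ⊆ 𝒰 := fun x hx => hx.1
  have hm : 0 ≤ m := setIntegral_nonneg
    (isOpen_sublevel_strip h𝒰 hUc ρm s).measurableSet fun x hx => hu0 x hx.1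
  have hQc := continuousOn_aQuad h𝒰 ha (hU.of_le one_le_two)
  have hUW : AEMeasurable U (volume.restrict W) := (hUc.mono hW𝒰).aemeasurable hW
  have huW : IntegrableOn u W := hu.mono_set hW𝒰
  obtain ⟨C, hC⟩ := hK.exists_bound_of_continuousOn (hQc.mono fun x hx => hx.1)
  have hQu : IntegrableOn (fun x => aQuad a U x * u x) W := by
    refine Integrable.bdd_mul (c := C) huW ((hQc.mono hW𝒰).aestronglyMeasurable hW) ?_
    filter_upwards [ae_restrict_mem hW] with x hx using hC x ⟨hx.1, hx.2.2.le⟩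
  have hQum : AEMeasurable (fun x => ENNReal.ofReal (aQuad a U x * u x)) (volume.restrict W) :=
    hQu.aestronglyMeasurable.aemeasurable.ennreal_ofReal
  set κ := (volume.restrict W).withDensity fun x => ENNReal.ofReal (aQuad a U x * u x)
  have : IsFiniteMeasure κ := isFiniteMeasure_withDensity_ofReal hQu.2
  have hUκ : AEMeasurable U κ := hUW.mono_ac (withDensity_absolutelyContinuous _ _)
  have hν : ∀ g : ℝ → ℝ, Measurable g → ∫⁻ r, ENNReal.ofReal (g r) ∂(κ.map U) =
      ∫⁻ x in W, ENNReal.ofReal (aQuad a U x * u x) * ENNReal.ofReal (g (U x)) := by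
    intro g hg
    rw [lintegral_map' hg.ennreal_ofReal.aemeasurable hUκ]
    exact lintegral_withDensity_eq_lintegral_mul₀ hQum
      (hg.comp_aemeasurable hUW).ennreal_ofReal
  have hcomp : (ENNReal.ofReal (γ * m) • volume.restrict (Set.Ioo s t)).restrict (Set.Ioo s t) ≤
      κ.map U := by
    have : IsFiniteMeasure (ENNReal.ofReal (γ * m) • volume.restrict (Set.Ioo s t)) :=
      Measure.smul_finite _ ENNReal.ofReal_ne_top
    refine measure_restrict_le_of_lintegral_le isOpen_Ioo fun θ hθ hθ0 hθc hθs => ?_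
    have hθ_int : Integrable θ := hθ.integrable_of_hasCompactSupport hθc
    have hθint := integrableOn_comp_mul_aQuad_mul h𝒰 ha hu hU hK hθ hθs
    have hle := strip_mass_mul_le_integral h𝒰 ha hQ hV hu hu0 hstat hU hγ hL hs hK hθ hθ0 hθc hθs
    rw [setIntegral_eq_of_subset_of_forall_sdiff_eq_zero h𝒰.measurableSet hW𝒰] at hle
    swap
    · rintro x ⟨hx, hxW⟩
      have : θ (U x) = 0 := image_eq_zero_of_notMem_tsupport fun h => hxW ⟨hx, hθs h⟩
      simp [this]
    rw [hν θ hθ.measurable, lintegral_smul_measure, smul_eq_mul]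
    calc ENNReal.ofReal (γ * m) * ∫⁻ r in Set.Ioo s t, ENNReal.ofReal (θ r)
        ≤ ENNReal.ofReal (γ * m) * ∫⁻ r, ENNReal.ofReal (θ r) :=
          mul_le_mul_right (setLIntegral_le_lintegral _ _) _
      _ = ENNReal.ofReal (γ * m * ∫ r, θ r) := by
          rw [ENNReal.ofReal_mul (mul_nonneg hγ hm),
            ofReal_integral_eq_lintegral_ofReal hθ_int (Filter.Eventually.of_forall hθ0)]
      _ ≤ ENNReal.ofReal (∫ x in W, θ (U x) * aQuad a U x * u x) := ENNReal.ofReal_le_ofReal hle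
      _ = ∫⁻ x in W, ENNReal.ofReal (θ (U x) * aQuad a U x * u x) := by
          refine ofReal_integral_eq_lintegral_ofReal ?_ ?_
          · exact hθint.mono_set hW𝒰
          · filter_upwards [ae_restrict_mem hW] with x hx
            exact mul_nonneg (mul_nonneg (hθ0 _) (hQ x hx.1)) (hu0 x hx.1)
      _ = ∫⁻ x in W, ENNReal.ofReal (aQuad a U x * u x) * ENNReal.ofReal (θ (U x)) := by
          refine setLIntegral_congr_fun hW fun x hx => ?_
          rw [← ENNReal.ofReal_mul (mul_nonneg (hQ x hx.1) (hu0 x hx.1))]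
          ring_nf
  have hHint' : IntegrableOn (fun r => 1 / H r) (Set.Ioo s t) :=
    ((intervalIntegrable_iff_integrableOn_Ioo_of_le hst).1 hHint)
  rw [← ENNReal.ofReal_le_ofReal_iff (setIntegral_nonneg hW fun x hx => hu0 x hx.1)]
  calc ENNReal.ofReal (γ * m * ∫ r in s..t, 1 / H r)
      = ENNReal.ofReal (γ * m) * ∫⁻ r in Set.Ioo s t, ENNReal.ofReal (1 / H r) := by
        rw [ENNReal.ofReal_mul (mul_nonneg hγ hm), intervalIntegral.integral_of_le hst,
          integral_Ioc_eq_integral_Ioo, ofReal_integral_eq_lintegral_ofReal hHint']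
        filter_upwards [ae_restrict_mem measurableSet_Ioo] with r hr
        exact (one_div_pos.2 (hHpos r hr)).le
    _ = ∫⁻ r, ENNReal.ofReal (1 / H r)
          ∂((ENNReal.ofReal (γ * m) • volume.restrict (Set.Ioo s t)).restrict (Set.Ioo s t)) := by
        rw [Measure.restrict_smul, Measure.restrict_restrict measurableSet_Ioo, Set.inter_self,
          lintegral_smul_measure, smul_eq_mul]
    _ ≤ ∫⁻ r, ENNReal.ofReal (1 / H r) ∂(κ.map U) := lintegral_mono' hcomp le_rfl
    _ = ∫⁻ x in W, ENNReal.ofReal (aQuad a U x * u x) * ENNReal.ofReal (1 / H (U x)) :=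
        hν _ (measurable_const.div hHm)
    _ ≤ ∫⁻ x in W, ENNReal.ofReal (u x) := by
        refine setLIntegral_mono' hW fun x hx => ?_
        have hHx := hHpos _ hx.2
        have hux := hu0 x hx.1
        rw [← ENNReal.ofReal_mul (mul_nonneg (hQ x hx.1) hux), mul_one_div]
        refine ENNReal.ofReal_le_ofReal ((div_le_iff₀ hHx).2 ?_)
        rw [mul_comm (u x)]
        exact mul_le_mul_of_nonneg_right (hHup x hx.1) hux
    _ = ENNReal.ofReal (∫ x in W, u x) := by
        rw [ofReal_integral_eq_lintegral_ofReal huW]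
        filter_upwards [ae_restrict_mem hW] with x hx using hu0 x hx.1

end AntiLyapunov

/-- Estimate (omegarhok-5.1): single-interval exponential growth in the proof of Theorem B(a). -/
theorem estimate_omegarhok
    {n : ℕ} (hn : 0 < n)
    (𝒰 : Set (Eucl n)) (hUopen : IsOpen 𝒰) (hUconn : IsConnected 𝒰)
    (a : Eucl n → Matrix (Fin n) (Fin n) ℝ)
    (ha_C1 : ∀ i j, ContDiffOn ℝ 1 (fun x => a x i j) 𝒰)
    (ha_symm : ∀ x ∈ 𝒰, ∀ i j, a x i j = a x j i)
    (ha_psd : ∀ x ∈ 𝒰, ∀ v : Fin n → ℝ, 0 ≤ ∑ i, ∑ j, a x i j * v i * v j)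
    (V : Eucl n → Fin n → ℝ) (hV_cont : ContinuousOn V 𝒰)
    (u : Eucl n → ℝ) (hu_C1 : ContDiffOn ℝ 1 u 𝒰) (hu_nonneg : ∀ x ∈ 𝒰, 0 ≤ u x)
    (hu_mass : (∫ x in 𝒰, u x) = 1)
    (hu_stat : ∀ f : Eucl n → ℝ, ContDiff ℝ (⊤ : ℕ∞) f → HasCompactSupport f →
      tsupport f ⊆ 𝒰 → (∫ x in 𝒰, Lop a V f x * u x) = 0)
    (U : Eucl n → ℝ) (ρM : EReal) (hU_C2 : ContDiffOn ℝ 2 U 𝒰)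
    (hU_nonneg : ∀ x ∈ 𝒰, 0 ≤ U x)
    (hU_lt : ∀ x ∈ 𝒰, (U x : EReal) < ρM)
    (hU_sup : ρM = ⨆ x : 𝒰, (U x.1 : EReal))
    (hU_cpt : ∀ ρ : ℝ, (ρ : EReal) < ρM → IsCompact {x ∈ 𝒰 | U x ≤ ρ})
    (ρm γ : ℝ) (hρm_pos : 0 < ρm) (hρm_lt : (ρm : EReal) < ρM) (hγ : 0 < γ)
    (hAnti : ∀ x ∈ 𝒰, x ∉ closure {y ∈ 𝒰 | U y < ρm} → γ ≤ Lop a V U x)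
    (H : ℝ → ℝ) (hH_meas : Measurable H)
    (hH_nonneg : ∀ t : ℝ, 0 ≤ t → (t : EReal) < ρM → 0 ≤ H t)
    (hH_locbdd : ∀ ρ : ℝ, (ρ : EReal) < ρM → BddAbove (H '' Set.Icc 0 ρ))
    (hH_up : ∀ x ∈ 𝒰, aQuad a U x ≤ H (U x))
    (hH_pos : ∀ t : ℝ, ρm ≤ t → (t : EReal) < ρM → 0 < H t)
    (hR : ∀ᵐ r ∂(volume.restrict {t : ℝ | ρm ≤ t ∧ (t : EReal) < ρM}),
      ∀ x ∈ 𝒰, U x = r → gradient U x ≠ 0)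
    (ηt η : ℝ) (hη1 : ρm < ηt) (hη2 : ηt ≤ η) (hη3 : (η : EReal) < ρM)
    (hreg : ∀ r ∈ Set.Ioo ηt η, ∀ x ∈ 𝒰, U x = r → gradient U x ≠ 0) :
    (∫ x in {x ∈ 𝒰 | ρm < U x ∧ U x < ηt}, u x) *
        Real.exp (γ * ∫ t in ηt..η, 1 / H t) ≤
      ∫ x in {x ∈ 𝒰 | ρm < U x ∧ U x < η}, u x := by
  have ha : ∀ i j, ContinuousOn (fun x => a x i j) 𝒰 := fun i j => (ha_C1 i j).continuousOn
  have hu : IntegrableOn u 𝒰 := by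
    by_contra h
    rw [integral_undef h] at hu_mass
    exact zero_ne_one hu_mass
  have hUc := hU_C2.continuousOn
  have hQ : ∀ x ∈ 𝒰, 0 ≤ aQuad a U x := fun x hx => ha_psd x hx fun i => pd U i x
  have hL : ∀ x ∈ 𝒰, ρm < U x → γ ≤ Lop a V U x := by
    intro x hx hρ
    refine hAnti x hx fun hcl => ?_
    have hsub : closure {y ∈ 𝒰 | U y < ρm} ⊆ {y ∈ 𝒰 | U y ≤ ρm} :=
      closure_minimal (fun y hy => ⟨hy.1, hy.2.le⟩) (hU_cpt ρm hρm_lt).isClosed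
    exact hρ.not_ge (hsub hcl).2
  have hlt : ∀ t : ℝ, t ≤ η → (t : EReal) < ρM := fun t ht =>
    (EReal.coe_le_coe_iff.2 ht).trans_lt hη3
  set M : ℝ → ℝ := fun s => ∫ x in {x ∈ 𝒰 | ρm < U x ∧ U x < s}, u x
  have hopen := isOpen_sublevel_strip hUopen hUc
  by_cases hint : IntervalIntegrable (fun t => 1 / H t) volume ηt η
  swap
  · rw [intervalIntegral.integral_undef hint, mul_zero, Real.exp_zero, mul_one]
    refine setIntegral_mono_set (hu.mono_set fun x hx => hx.1) ?_
      (Filter.Eventually.of_forall fun x hx => ⟨hx.1, hx.2.1, hx.2.2.trans_le hη2⟩)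
    filter_upwards [ae_restrict_mem (hopen ρm η).measurableSet] with x hx using hu_nonneg x hx.1
  have hsubint : ∀ s t, ηt ≤ s → s ≤ t → t ≤ η →
      IntervalIntegrable (fun t => 1 / H t) volume s t := fun s t hs hst ht =>
    hint.mono_set (by
      rw [Set.uIcc_of_le hst, Set.uIcc_of_le hη2]
      exact Set.Icc_subset_Icc hs ht)
  have hcont : ContinuousOn (fun r => γ * ∫ t in ηt..r, 1 / H t) (Set.Icc ηt η) := by
    rw [← Set.uIcc_of_le hη2]
    refine continuousOn_const.mul (intervalIntegral.continuousOn_primitive_interval ?_)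
    rw [Set.uIcc_of_le hη2]
    exact (intervalIntegrable_iff_integrableOn_Icc_of_le hη2).1 hint
  have hinc : ∀ s t, ηt ≤ s → s ≤ t → t ≤ η →
      M s * (1 + (γ * (∫ r in ηt..t, 1 / H r) - γ * ∫ r in ηt..s, 1 / H r)) ≤ M t := by
    intro s t hs hst ht
    rw [← mul_sub, intervalIntegral.integral_interval_sub_left
      (hsubint ηt t le_rfl (hs.trans hst) ht) (hsubint ηt s le_rfl hs (hst.trans ht))]
    have h1 := strip_mass_increment_le hUopen ha hQ hV_cont hu hu_nonneg hu_stat hU_C2 hγ.le hL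
      (hη1.trans_le hs) hst (hU_cpt t (hlt t ht)) hH_meas
      (fun r hr => hH_pos r (by linarith [hr.1]) (hlt r (hr.2.le.trans ht))) hH_up
      (hsubint s t hs hst ht)
    have h2 : M s + (∫ x in {x ∈ 𝒰 | s < U x ∧ U x < t}, u x) ≤ M t := by
      have hdisj : Disjoint {x ∈ 𝒰 | ρm < U x ∧ U x < s} {x ∈ 𝒰 | s < U x ∧ U x < t} :=
        Set.disjoint_left.2 fun x hx hx' => hx.2.2.not_gt hx'.2.1
      rw [← setIntegral_union hdisj (hopen s t).measurableSet
        (hu.mono_set fun x hx => hx.1) (hu.mono_set fun x hx => hx.1)]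
      refine setIntegral_mono_set (hu.mono_set fun x hx => hx.1) ?_
        (Filter.Eventually.of_forall ?_)
      · filter_upwards [ae_restrict_mem (hopen ρm t).measurableSet] with x hx
          using hu_nonneg x hx.1
      · rintro x (hx | hx)
        · exact ⟨hx.1, hx.2.1, hx.2.2.trans_le hst⟩
        · exact ⟨hx.1, (hη1.trans_le hs).trans hx.2.1, hx.2.2⟩
    change γ * M s * _ ≤ _ at h1
    linarith
  have hnonneg : 0 ≤ ∫ t in ηt..η, 1 / H t :=
    intervalIntegral.integral_nonneg hη2 fun t ht =>
      (one_div_pos.2 (hH_pos t (by linarith [ht.1]) (hlt t ht.2))).le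
  have := mul_exp_le_of_increment_le hη2 hcont
    (by simpa using mul_nonneg hγ.le hnonneg) hinc
  rwa [intervalIntegral.integral_same, mul_zero, sub_zero] at this
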